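/- Let (G,+) be an additive commutative monoid and let G = B₁ ∪ ⋯ ∪ B_q be a partition of G into finitely many subsets. Then there exists an index j ∈ {1,…,q} with the following property: for every finite set F ⊆ G there is a syndetic subset D_F of (ℕ,+) such that for each d ∈ D_F there exists a ∈ B_j with a + d•F ⊆ B_j, where d•g denotes g added to itself d times (the canonical ℕ-scalar multiplication) and a + d•F = {a + d•g : g ∈ F}. -/

import Mathlib

/-- A subset `N` of `(ℕ,+)` is syndetic if there is a finite set `K ⊆ ℕ` such that
`(K + t) ∩ N ≠ ∅` for every `t ∈ ℕ`. -/
def Syndetic (N : Set ℕ) : Prop :=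
  ∃ K : Finset ℕ, ∀ t : ℕ, ∃ k ∈ K, k + t ∈ N

/-- A set `T ⊆ ℕ` containing arbitrarily long intervals contains all nonempty subset sums of some
family indexed by any given finite set. -/
theorem exists_sum_mem_of_thick {ι : Type*} {T : Set ℕ}
    (hT : ∀ L : ℕ, ∃ t, ∀ k ≤ L, k + t ∈ T) (A : Finset ι) :
    ∃ d : ι → ℕ, ∀ s ⊆ A, s.Nonempty → ∑ i ∈ s, d i ∈ T := by
  classical
  induction A using Finset.induction_on with
  | empty =>
    exact ⟨0, fun s hs hne => absurd (Finset.subset_empty.1 hs) hne.ne_empty⟩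
  | insert i A hi ih =>
    obtain ⟨d, hd⟩ := ih
    obtain ⟨t, ht⟩ := hT (∑ k ∈ A, d k)
    have hupd : ∀ s : Finset ι, i ∉ s → ∑ k ∈ s, Function.update d i t k = ∑ k ∈ s, d k :=
      fun s his => Finset.sum_congr rfl fun k hk =>
        Function.update_of_ne (ne_of_mem_of_not_mem hk his) _ _
    refine ⟨Function.update d i t, fun s hs hne => ?_⟩
    by_cases his : i ∈ s
    · rw [← Finset.sum_erase_add s _ his, hupd _ (Finset.notMem_erase i s),
        Function.update_self]
      exact ht _ (Finset.sum_le_sum_of_subset (Finset.subset_insert_iff.1 hs))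
    · rw [hupd s his]
      exact hd s ((Finset.subset_insert_iff_of_notMem his).1 hs) hne

/-- If finitely many translates of `X` cover `G`, and the set of `d` for which `B` contains a
configuration `a, a + d • F` misses arbitrarily long intervals, then finitely many translates of
`X \ B` cover `G`. -/
theorem exists_finset_add_mem_diff {G : Type*} [AddCommMonoid G] {X B : Set G} {F S : Finset G}
    (hS : ∀ a, ∃ s ∈ S, a + s ∈ X)
    (hB : ∀ L : ℕ, ∃ t, ∀ k ≤ L, ¬ ∃ a ∈ B, ∀ g ∈ F, a + (k + t) • g ∈ B) :
    ∃ S' : Finset G, ∀ a, ∃ s ∈ S', a + s ∈ X \ B := by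
  classical
  obtain ⟨ι, _, hι⟩ :=
    Combinatorics.Line.exists_mono_in_high_dimension ↥(insert 0 F : Finset G) ↥S
  obtain ⟨d, hd⟩ := exists_sum_mem_of_thick
    (T := {d : ℕ | ¬ ∃ a ∈ B, ∀ g ∈ F, a + d • g ∈ B}) hB (Finset.univ : Finset ι)
  let p : (ι → ↥(insert 0 F : Finset G)) → G := fun v => ∑ i, d i • (v i : G)
  refine ⟨Finset.image₂ (fun v s => p v + s) Finset.univ S, fun a => ?_⟩
  by_contra! hcon
  choose c hcS hcX using hS
  obtain ⟨l, s, hl⟩ := hι fun v => ⟨c (a + p v), hcS _⟩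
  have hmem : ∀ x, a + (p (l x) + s) ∈ B := by
    intro x
    by_contra hx
    have hs : c (a + p (l x)) = s := congrArg Subtype.val (hl x)
    refine hcon _ (Finset.mem_image₂_of_mem (Finset.mem_univ (l x)) s.2) ⟨?_, hx⟩
    rw [← add_assoc, ← hs]
    exact hcX _
  let N : Finset ι := {i | l.idxFun i = none}
  let z : ↥(insert 0 F : Finset G) := ⟨0, Finset.mem_insert_self 0 F⟩
  have hp : ∀ x, p (l x) = p (l z) + (∑ i ∈ N, d i) • (x : G) := by
    intro x
    simp only [p, N, Finset.sum_smul, Finset.sum_filter, ← Finset.sum_add_distrib]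
    refine Finset.sum_congr rfl fun i _ => ?_
    cases h : l.idxFun i <;> simp [h, z]
  obtain ⟨i, hi⟩ := l.proper
  refine hd N (Finset.subset_univ N) ⟨i, by simpa [N] using hi⟩
    ⟨a + (p (l z) + s), hmem z, fun g hg => ?_⟩
  have hg' := hmem ⟨g, Finset.mem_insert_of_mem hg⟩
  rw [hp] at hg'
  convert hg' using 1
  abel

/-- Van der Waerden's theorem for semigroups (additive commutative monoids viewed as
`ℕ`-semimodules): for any finite coloring `G = B₁ ∪ ⋯ ∪ B_q`, some color `B j` has the
property that for every finite `F ⊆ G` there is a syndetic set `D_F ⊆ ℕ` such that for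
each `d ∈ D_F` there is `a ∈ B j` with `a + d • F ⊆ B j`. -/
theorem vdW_addCommMonoid {G : Type*} [AddCommMonoid G]
    {q : ℕ} (B : Fin q → Set G) (hcover : (⋃ j, B j) = Set.univ) :
    ∃ j : Fin q, ∀ F : Finset G, ∃ D : Set ℕ, Syndetic D ∧
      ∀ d ∈ D, ∃ a ∈ B j, ∀ g ∈ F, a + d • g ∈ B j := by
  classical
  by_contra! hcon
  choose F hF using hcon
  have hB : ∀ j, ∀ L : ℕ, ∃ t, ∀ k ≤ L, ¬ ∃ a ∈ B j, ∀ g ∈ F j, a + (k + t) • g ∈ B j := by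
    intro j L
    by_contra! hL
    obtain ⟨d, ⟨a, ha, hag⟩, hd⟩ := hF j {d | ∃ a ∈ B j, ∀ g ∈ F j, a + d • g ∈ B j}
      ⟨Finset.range (L + 1), fun t => by
        obtain ⟨k, hk, h⟩ := hL t
        exact ⟨k, Finset.mem_range_succ_iff.2 hk, h⟩⟩
    obtain ⟨g, hg, hgB⟩ := hd a ha
    exact hgB (hag g hg)
  have key : ∀ A : Finset (Fin q), ∃ S : Finset G,
      ∀ a, ∃ s ∈ S, a + s ∈ {x | ∀ j ∈ A, x ∉ B j} := by
    intro A
    induction A using Finset.induction_on with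
    | empty => exact ⟨{0}, fun a => ⟨0, by simp⟩⟩
    | insert j A _ ih =>
      obtain ⟨S, hS⟩ := ih
      obtain ⟨S', hS'⟩ := exists_finset_add_mem_diff hS (hB j)
      refine ⟨S', fun a => ?_⟩
      obtain ⟨s, hs, hX, hj⟩ := hS' a
      exact ⟨s, hs, (Finset.forall_mem_insert _ _ _).2 ⟨hj, hX⟩⟩
  obtain ⟨S, hS⟩ := key Finset.univ
  obtain ⟨s, -, hs⟩ := hS 0
  obtain ⟨j, hj⟩ := Set.mem_iUnion.1 (hcover.symm ▸ Set.mem_univ (0 + s))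
  exact hs j (Finset.mem_univ j) hj
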